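/- arXiv:2507.08755 — 3 statements merged into one kernel-verified Lean document; each statement's English description precedes it below -/
import Mathlib

section
/- Assume the subgroup construction with 3 ≤ k and 2k ≤ n, λ_1, λ_2 ∉ H, λ_1 ≠ λ_2, and λ_1, λ_2 ≠ 0. Then C_2(b,c) is not equivalent to RS_{k,n+1}(a') for any pairwise distinct a'_1, …, a'_{n+1} ∈ F, nor to the extended code RS_{k,n}(a',∞) for any pairwise distinct a'_1, …, a'_n ∈ F. -/
open Matrix Finset

/-- The `k × (m+1)` one-column-twisted generator matrix `G_1(b,c)`:
columns `0,…,m-1` are `(a_j^s)_s`, last column is `(b^s - λ c^s)_s`. -/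
def G1mat {F : Type*} [Field F] (k m : ℕ) (a : Fin m → F) (b c lam : F) :
    Matrix (Fin k) (Fin (m + 1)) F :=
  Matrix.of fun s j =>
    if h : (j : ℕ) < m then a ⟨j, h⟩ ^ (s : ℕ)
    else b ^ (s : ℕ) - lam * c ^ (s : ℕ)

/-- The extended matrix `G_1(b,c,∞)`, with the extra column `(0,…,0,1)ᵀ`. -/
def G1matInf {F : Type*} [Field F] (k m : ℕ) (a : Fin m → F) (b c lam : F) :
    Matrix (Fin k) (Fin (m + 2)) F :=
  Matrix.of fun s j =>
    if h : (j : ℕ) < m then a ⟨j, h⟩ ^ (s : ℕ)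
    else if (j : ℕ) = m then b ^ (s : ℕ) - lam * c ^ (s : ℕ)
    else if (s : ℕ) = k - 1 then 1 else 0

/-- The `k × (m+2)` two-column-twisted generator matrix `G_2(b,c)`. -/
def G2mat {F : Type*} [Field F] (k m : ℕ) (a : Fin m → F) (b c l1 l2 : F) :
    Matrix (Fin k) (Fin (m + 2)) F :=
  Matrix.of fun s j =>
    if h : (j : ℕ) < m then a ⟨j, h⟩ ^ (s : ℕ)
    else if (j : ℕ) = m then b ^ (s : ℕ) - l1 * c ^ (s : ℕ)
    else b ^ (s : ℕ) - l2 * c ^ (s : ℕ)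

/-- The extended matrix `G_2(b,c,∞)`, with the extra column `(0,…,0,1)ᵀ`. -/
def G2matInf {F : Type*} [Field F] (k m : ℕ) (a : Fin m → F) (b c l1 l2 : F) :
    Matrix (Fin k) (Fin (m + 3)) F :=
  Matrix.of fun s j =>
    if h : (j : ℕ) < m then a ⟨j, h⟩ ^ (s : ℕ)
    else if (j : ℕ) = m then b ^ (s : ℕ) - l1 * c ^ (s : ℕ)
    else if (j : ℕ) = m + 1 then b ^ (s : ℕ) - l2 * c ^ (s : ℕ)
    else if (s : ℕ) = k - 1 then 1 else 0

/-- The code generated by a matrix: the span of its rows. -/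
def rowSpan {F : Type*} [Field F] {k N : ℕ} (G : Matrix (Fin k) (Fin N) F) :
    Submodule F (Fin N → F) :=
  Submodule.span F (Set.range fun s => G s)

/-- Every `k` columns of the `k × N` matrix `G` are linearly independent. -/
def colsIndep {F : Type*} [Field F] {k N : ℕ} (G : Matrix (Fin k) (Fin N) F) : Prop :=
  ∀ e : Fin k → Fin N, Function.Injective e → (G.submatrix id e).det ≠ 0

/-- Minimum Hamming distance (= minimum Hamming weight) of a linear code. -/
noncomputable def minDist {F : Type*} [Field F] [DecidableEq F] {N : ℕ}
    (C : Submodule F (Fin N → F)) : ℕ :=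
  sInf {d | ∃ x ∈ C, x ≠ 0 ∧ hammingNorm x = d}

/-- The Schur (componentwise) product of two linear codes. -/
def schurMul {F : Type*} [Field F] {N : ℕ} (C D : Submodule F (Fin N → F)) :
    Submodule F (Fin N → F) :=
  Submodule.span F {x | ∃ c ∈ C, ∃ d ∈ D, x = c * d}

/-- The Reed–Solomon code `RS_{k,N}(a)`. -/
def RSCode {F : Type*} [Field F] (k N : ℕ) (a : Fin N → F) : Submodule F (Fin N → F) :=
  Submodule.span F
    {x | ∃ f : Polynomial F, f.degree < (k : WithBot ℕ) ∧ x = fun j => f.eval (a j)}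

/-- The extended Reed–Solomon code `RS_{k,n-1}(a,∞)` of total length `n`. -/
def RSextCode {F : Type*} [Field F] (k n : ℕ) (a : Fin (n - 1) → F) :
    Submodule F (Fin n → F) :=
  Submodule.span F
    {x | ∃ f : Polynomial F, f.degree < (k : WithBot ℕ) ∧
      x = fun j : Fin n =>
        if h : (j : ℕ) < n - 1 then f.eval (a ⟨j, h⟩) else f.coeff (k - 1)}

/-- Equivalence of linear codes: equal up to a permutation of coordinates and
multiplication by nonzero scalars in each coordinate. -/
def codeEquiv {F : Type*} [Field F] {N : ℕ} (C D : Submodule F (Fin N → F)) : Prop :=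
  ∃ π : Equiv.Perm (Fin N), ∃ v : Fin N → F, (∀ i, v i ≠ 0) ∧
    (C : Set (Fin N → F)) =
      (fun x : Fin N → F => fun i => v i * x (π i)) '' (D : Set (Fin N → F))

/-- The dual code with respect to the standard bilinear form. -/
def dualCode {F : Type*} [Field F] {N : ℕ} (C : Submodule F (Fin N → F)) :
    Submodule F (Fin N → F) where
  carrier := {y | ∀ x ∈ C, ∑ i, x i * y i = 0}
  add_mem' := by
    intro y z hy hz x hx
    have hy' := hy x hx
    have hz' := hz x hx
    simp only [Set.mem_setOf_eq, Pi.add_apply, mul_add, Finset.sum_add_distrib, hy', hz',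
      add_zero]
  zero_mem' := by intro x hx; simp
  smul_mem' := by
    intro c y hy x hx
    have h := hy x hx
    simp only [Set.mem_setOf_eq, Pi.smul_apply, smul_eq_mul, mul_left_comm, ← Finset.mul_sum,
      h, mul_zero]

/-- Words of `D` with `y₁ y₃ = y₂²` on at least `N` coordinates satisfy this relation everywhere. -/
def QuadraticRigid {F : Type*} [Field F] {n : ℕ} (N : ℕ) (D : Submodule F (Fin n → F)) : Prop :=
  ∀ y₁ ∈ D, ∀ y₂ ∈ D, ∀ y₃ ∈ D, ∀ S : Finset (Fin n), N ≤ S.card →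
    (∀ j ∈ S, y₁ j * y₃ j = y₂ j * y₂ j) → ∀ j, y₁ j * y₃ j = y₂ j * y₂ j

lemma exists_polynomial_of_mem_RSCode {F : Type*} [Field F] {k n : ℕ} {a : Fin n → F}
    {x : Fin n → F} (hx : x ∈ RSCode k n a) :
    ∃ f : Polynomial F, f.degree < (k : WithBot ℕ) ∧ x = fun j => f.eval (a j) := by
  induction hx using Submodule.span_induction with
  | mem x h => exact h
  | zero => exact ⟨0, by simp, by ext; simp⟩
  | add x y _ _ hx hy =>
    obtain ⟨f, hf, rfl⟩ := hx
    obtain ⟨g, hg, rfl⟩ := hy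
    exact ⟨f + g, (Polynomial.degree_add_le f g).trans_lt (max_lt hf hg), by ext; simp⟩
  | smul r x _ hx =>
    obtain ⟨f, hf, rfl⟩ := hx
    exact ⟨r • f, (Polynomial.degree_smul_le r f).trans_lt hf, by ext; simp⟩

lemma exists_polynomial_of_mem_RSextCode {F : Type*} [Field F] {k n : ℕ} {a : Fin n → F}
    {x : Fin (n + 1) → F} (hx : x ∈ RSextCode k (n + 1) a) :
    ∃ f : Polynomial F, f.degree < (k : WithBot ℕ) ∧
      (∀ i : Fin n, x i.castSucc = f.eval (a i)) ∧ x (Fin.last n) = f.coeff (k - 1) := by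
  induction hx using Submodule.span_induction with
  | mem x h =>
    obtain ⟨f, hf, rfl⟩ := h
    exact ⟨f, hf, by simp, by simp⟩
  | zero => exact ⟨0, by simp, by simp, by simp⟩
  | add x y _ _ hx hy =>
    obtain ⟨f, hf, hf₁, hf₂⟩ := hx
    obtain ⟨g, hg, hg₁, hg₂⟩ := hy
    exact ⟨f + g, (Polynomial.degree_add_le f g).trans_lt (max_lt hf hg),
      by simp [hf₁, hg₁], by simp [hf₂, hg₂]⟩
  | smul r x _ hx =>
    obtain ⟨f, hf, hf₁, hf₂⟩ := hx
    exact ⟨r • f, (Polynomial.degree_smul_le r f).trans_lt hf, by simp [hf₁], by simp [hf₂]⟩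

lemma natDegree_le_pred_of_degree_lt {F : Type*} [Field F] {k : ℕ} {f : Polynomial F}
    (hf : f.degree < (k : WithBot ℕ)) : f.natDegree ≤ k - 1 := by
  by_cases h0 : f = 0
  · simp [h0]
  · have := (Polynomial.natDegree_lt_iff_degree_lt h0).2 hf
    omega

lemma natDegree_mul_sub_mul_self_le {F : Type*} [Field F] {d : ℕ} {f g h : Polynomial F}
    (hf : f.natDegree ≤ d) (hg : g.natDegree ≤ d) (hh : h.natDegree ≤ d) :
    (f * h - g * g).natDegree ≤ d + d :=
  (Polynomial.natDegree_sub_le _ _).trans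
    (max_le (Polynomial.natDegree_mul_le_of_le hf hh) (Polynomial.natDegree_mul_le_of_le hg hg))

lemma eq_zero_of_eval_eq_zero_of_natDegree_lt {F ι : Type*} [Field F] {a : ι → F}
    (ha : Function.Injective a) {q : Polynomial F} (S : Finset ι)
    (hq : ∀ i ∈ S, q.eval (a i) = 0) (hS : q.natDegree < S.card) : q = 0 :=
  Polynomial.eq_zero_of_natDegree_lt_card_of_eval_eq_zero' q (S.map ⟨a, ha⟩)
    (by simpa using hq) (by simpa using hS)

lemma quadraticRigid_RSCode {F : Type*} [Field F] {k n : ℕ} (hk : 1 ≤ k) {a : Fin n → F}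
    (ha : Function.Injective a) : QuadraticRigid (2 * k - 1) (RSCode k n a) := by
  intro y₁ h₁ y₂ h₂ y₃ h₃ S hS hy j
  obtain ⟨f, hf, rfl⟩ := exists_polynomial_of_mem_RSCode h₁
  obtain ⟨g, hg, rfl⟩ := exists_polynomial_of_mem_RSCode h₂
  obtain ⟨h, hh, rfl⟩ := exists_polynomial_of_mem_RSCode h₃
  have hdeg := natDegree_mul_sub_mul_self_le (natDegree_le_pred_of_degree_lt hf)
    (natDegree_le_pred_of_degree_lt hg) (natDegree_le_pred_of_degree_lt hh)
  have hq : f * h - g * g = 0 := eq_zero_of_eval_eq_zero_of_natDegree_lt ha S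
    (fun i hi => by simpa [sub_eq_zero] using hy i hi) (by omega)
  simpa using congrArg (Polynomial.eval (a j)) (sub_eq_zero.1 hq)

lemma quadraticRigid_RSextCode {F : Type*} [Field F] {k n : ℕ} (hk : 1 ≤ k) {a : Fin n → F}
    (ha : Function.Injective a) : QuadraticRigid (2 * k - 1) (RSextCode k (n + 1) a) := by
  intro y₁ h₁ y₂ h₂ y₃ h₃ S hS hy
  obtain ⟨f, hf, hf₁, hf₂⟩ := exists_polynomial_of_mem_RSextCode h₁
  obtain ⟨g, hg, hg₁, hg₂⟩ := exists_polynomial_of_mem_RSextCode h₂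
  obtain ⟨h, hh, hh₁, hh₂⟩ := exists_polynomial_of_mem_RSextCode h₃
  replace hf := natDegree_le_pred_of_degree_lt hf
  replace hg := natDegree_le_pred_of_degree_lt hg
  replace hh := natDegree_le_pred_of_degree_lt hh
  have hdeg := natDegree_mul_sub_mul_self_le hf hg hh
  have hcoeff : (f * h - g * g).coeff (k - 1 + (k - 1)) =
      y₁ (Fin.last n) * y₃ (Fin.last n) - y₂ (Fin.last n) * y₂ (Fin.last n) := by
    rw [Polynomial.coeff_sub, Polynomial.coeff_mul_add_eq_of_natDegree_le hf hh,
      Polynomial.coeff_mul_add_eq_of_natDegree_le hg hg, hf₂, hg₂, hh₂]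
  have hq : f * h - g * g = 0 := by
    set T : Finset (Fin n) := univ.filter fun i => i.castSucc ∈ S with hT
    have hroot : ∀ i ∈ T, (f * h - g * g).eval (a i) = 0 := fun i hi => by
      have := hy i.castSucc (by simpa [hT] using hi)
      simpa [sub_eq_zero, hf₁, hg₁, hh₁] using this
    have hST : S.erase (Fin.last n) = T.map Fin.castSuccEmb := by
      ext i
      induction i using Fin.lastCases <;> simp [hT, Fin.castSucc_ne_last]
    have hcard : (S.erase (Fin.last n)).card = T.card := by rw [hST, card_map]
    by_contra hne
    refine hne (eq_zero_of_eval_eq_zero_of_natDegree_lt ha T hroot ?_)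
    by_cases hlast : Fin.last n ∈ S
    · rw [hy _ hlast, sub_self] at hcoeff
      have hlt : (f * h - g * g).natDegree ≠ k - 1 + (k - 1) := fun heq => by
        rw [← heq, Polynomial.coeff_natDegree, Polynomial.leadingCoeff_eq_zero] at hcoeff
        exact hne hcoeff
      rw [card_erase_of_mem hlast] at hcard
      omega
    · rw [erase_eq_of_notMem hlast] at hcard
      omega
  intro j
  induction j using Fin.lastCases with
  | last => simpa [hq, sub_eq_zero, eq_comm] using hcoeff
  | cast i =>
    rw [hf₁, hg₁, hh₁]
    simpa using congrArg (Polynomial.eval (a i)) (sub_eq_zero.1 hq)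

lemma QuadraticRigid.of_codeEquiv {F : Type*} [Field F] {n N : ℕ}
    {C D : Submodule F (Fin n → F)} (hD : QuadraticRigid N D) (hCD : codeEquiv C D) :
    QuadraticRigid N C := by
  obtain ⟨π, v, hv, hC⟩ := hCD
  have key : ∀ y ∈ C, ∃ x ∈ D, (fun i => v i * x (π i)) = y := fun y hy => by
    rw [← SetLike.mem_coe, hC] at hy
    exact hy
  intro y₁ h₁ y₂ h₂ y₃ h₃ S hS hy j
  obtain ⟨x₁, hx₁, rfl⟩ := key _ h₁
  obtain ⟨x₂, hx₂, rfl⟩ := key _ h₂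
  obtain ⟨x₃, hx₃, rfl⟩ := key _ h₃
  have hx : ∀ i ∈ S.map π.toEmbedding, x₁ i * x₃ i = x₂ i * x₂ i := by
    intro i hi
    obtain ⟨j, hj, rfl⟩ := mem_map.1 hi
    refine mul_left_cancel₀ (mul_ne_zero (hv j) (hv j)) ?_
    simpa [mul_mul_mul_comm] using hy j hj
  have := hD x₁ hx₁ x₂ hx₂ x₃ hx₃ _ (by simpa using hS) hx (π j)
  simp only [mul_mul_mul_comm (v j), this]

lemma not_quadraticRigid_rowSpan_G2mat {F : Type*} [Field F] {m k N : ℕ} (hk : 3 ≤ k)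
    (hN : N ≤ m) (a : Fin m → F) {b c l1 l2 : F} (hbc : b ≠ c) (hl1 : l1 ≠ 0) :
    ¬ QuadraticRigid N (rowSpan (G2mat k m a b c l1 l2)) := by
  intro hC
  set G := G2mat k m a b c l1 l2 with hG
  have hrow : ∀ s, G s ∈ rowSpan G := fun s => Submodule.subset_span ⟨s, rfl⟩
  let r : Fin 3 → Fin (m + 2) → F := fun s => G (Fin.castLE hk s)
  have hr : ∀ s, r s ∈ rowSpan G := fun s => hrow _
  have h := hC (r 0) (hr 0) (r 1 - c • r 0)
    (sub_mem (hr 1) (Submodule.smul_mem _ _ (hr 0)))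
    (r 2 - (2 * c) • r 1 + c ^ 2 • r 0)
    (add_mem (sub_mem (hr 2) (Submodule.smul_mem _ _ (hr 1))) (Submodule.smul_mem _ _ (hr 0)))
    (univ.map (Fin.castAddEmb 2)) (by simpa using hN) (by
      intro j hj
      obtain ⟨i, -, rfl⟩ := mem_map.1 hj
      simp [r, hG, G2mat]
      ring) ⟨m, by omega⟩
  simp [r, hG, G2mat] at h
  refine mul_ne_zero hl1 (pow_ne_zero 2 (sub_ne_zero.2 hbc)) ?_
  linear_combination -h

/-- Subgroup construction (`n = m+1`), `3 ≤ k`, `2k ≤ n`,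
`λ_1, λ_2 ∉ H`, `λ_1 ≠ λ_2`, `λ_1, λ_2 ≠ 0`. Then `C_2(b,c)` is not equivalent to
`RS_{k,n+1}(a')` for any pairwise distinct `a'_1,…,a'_{n+1}`, nor to the extended code
`RS_{k,n}(a',∞)` for any pairwise distinct `a'_1,…,a'_n`. -/
theorem C2_not_equiv_RS {F : Type*} [Field F] [Fintype F] (m k : ℕ)
    (hk3 : 3 ≤ k) (hkn : 2 * k ≤ m + 1)
    (H : Subgroup Fˣ) (μ : Fin m → Fˣ)
    (hμH : ∀ i, μ i ∈ H) (hμ1 : ∀ i, μ i ≠ 1) (hμinj : Function.Injective μ)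
    (b c l1 l2 : F) (hbc : b ≠ c) (hl : l1 ≠ l2) (hl10 : l1 ≠ 0) (hl20 : l2 ≠ 0)
    (hl1 : ∀ u : Fˣ, u ∈ H → (u : F) ≠ l1) (hl2 : ∀ u : Fˣ, u ∈ H → (u : F) ≠ l2)
    (a : Fin m → F) (ha : ∀ i, a i = (b - (μ i : F) * c) / (1 - (μ i : F))) :
    (∀ a' : Fin (m + 2) → F, Function.Injective a' →
        ¬ codeEquiv (rowSpan (G2mat k m a b c l1 l2)) (RSCode k (m + 2) a')) ∧
    (∀ a' : Fin (m + 1) → F, Function.Injective a' →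
        ¬ codeEquiv (rowSpan (G2mat k m a b c l1 l2)) (RSextCode k (m + 2) a')) := by
  have hC := not_quadraticRigid_rowSpan_G2mat (N := 2 * k - 1) (l2 := l2) hk3 (by omega) a hbc hl10
  exact ⟨fun a' ha' hE => hC ((quadraticRigid_RSCode (by omega) ha').of_codeEquiv hE),
    fun a' ha' hE => hC ((quadraticRigid_RSextCode (by omega) ha').of_codeEquiv hE)⟩
end

section
/- Let q be an odd prime power and let n, k be integers with 3 ≤ k, 2k ≤ n, and 2n ≤ q + 3. Then there exists a linear code C ⊆ (F_q)^n of dimension k whose minimum Hamming distance equals n − k + 1 (i.e., C is MDS) and whose Schur square C^2 has dimension exactly 2k over F_q; in particular, C is not equivalent to any k-dimensional Reed–Solomon or extended Reed–Solomon code over F_q. -/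
open Matrix Finset

namespace TwistedRS

open Polynomial

section Polynomial

variable {F : Type*} [Field F]

lemma finrank_degreeLT (N : ℕ) : Module.finrank F (degreeLT F N) = N := by
  rw [(degreeLTEquiv F N).finrank_eq, Module.finrank_fin_fun]

instance (N : ℕ) : Module.Finite F (degreeLT F N) :=
  Module.Finite.equiv (degreeLTEquiv F N).symm

lemma natDegree_le_of_mem_degreeLT {d : ℕ} {f : F[X]} (hf : f ∈ degreeLT F (d + 1)) :
    f.natDegree ≤ d := by
  rw [natDegree_le_iff_coeff_eq_zero]
  intro N hN
  exact (degree_lt_iff_coeff_zero f (d + 1)).1 (mem_degreeLT.1 hf) N hN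

lemma mem_degreeLT_of_natDegree_le {d : ℕ} {f : F[X]} (hf : f.natDegree ≤ d) :
    f ∈ degreeLT F (d + 1) :=
  mem_degreeLT.2 ((degree_lt_iff_coeff_zero f (d + 1)).2 fun _ hN =>
    natDegree_le_iff_coeff_eq_zero.1 hf _ hN)

lemma mul_mem_degreeLT {d : ℕ} {f g : F[X]} (hf : f ∈ degreeLT F (d + 1))
    (hg : g ∈ degreeLT F (d + 1)) : f * g ∈ degreeLT F (d + d + 1) :=
  mem_degreeLT_of_natDegree_le (natDegree_mul_le.trans
    (add_le_add (natDegree_le_of_mem_degreeLT hf) (natDegree_le_of_mem_degreeLT hg)))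

lemma coeff_add_mul_of_mem_degreeLT {d : ℕ} {f g : F[X]} (hf : f ∈ degreeLT F (d + 1))
    (hg : g ∈ degreeLT F (d + 1)) : (f * g).coeff (d + d) = f.coeff d * g.coeff d :=
  coeff_mul_add_eq_of_natDegree_le (natDegree_le_of_mem_degreeLT hf)
    (natDegree_le_of_mem_degreeLT hg)

/-- A polynomial of degree at most `#I` vanishing at `#I` distinct points is a multiple of the
nodal polynomial. -/
lemma eq_C_mul_prod_of_vanishing {ι : Type*} {a : ι → F} (ha : Function.Injective a)
    (I : Finset ι) {f : F[X]} (hf : f.natDegree ≤ #I) (hI : ∀ i ∈ I, f.eval (a i) = 0) :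
    f = C (f.coeff #I) * ∏ i ∈ I, (X - C (a i)) := by
  have hmonic : (∏ i ∈ I, (X - C (a i))).Monic := monic_prod_of_monic _ _ fun i _ => monic_X_sub_C _
  have hdeg : (∏ i ∈ I, (X - C (a i))).natDegree = #I := by
    rw [natDegree_prod_of_monic _ _ fun i _ => monic_X_sub_C _]
    simp
  refine eq_of_degree_sub_lt_of_eval_index_eq I ha.injOn ?_ fun i hi => ?_
  · rw [degree_lt_iff_coeff_zero]
    intro N hN
    rcases hN.eq_or_lt with rfl | hN
    · have h1 : (∏ i ∈ I, (X - C (a i))).coeff #I = 1 := by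
        rw [← hdeg]; exact hmonic.coeff_natDegree
      simp [h1]
    · rw [coeff_sub, coeff_C_mul, coeff_eq_zero_of_natDegree_lt (hf.trans_lt hN),
        coeff_eq_zero_of_natDegree_lt (hdeg.trans_lt hN)]
      simp
  · rw [hI i hi, eval_mul, eval_prod, Finset.prod_eq_zero hi (by simp), mul_zero]

lemma coeff_zero_of_vanishing {ι : Type*} {a : ι → F} (ha : Function.Injective a)
    (I : Finset ι) {f : F[X]} (hf : f.natDegree ≤ #I) (hI : ∀ i ∈ I, f.eval (a i) = 0) :
    f.coeff 0 = f.coeff #I * ((-1) ^ #I * ∏ i ∈ I, a i) := by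
  conv_lhs => rw [eq_C_mul_prod_of_vanishing ha I hf hI]
  rw [coeff_zero_eq_eval_zero, eval_mul, eval_prod, eval_C]
  simp [Finset.prod_neg]

end Polynomial

section SchurSquare

variable {F : Type*} [Field F]

lemma finrank_schurMul_le_of_codeEquiv {N : ℕ} {C D : Submodule F (Fin N → F)}
    (h : codeEquiv C D) :
    Module.finrank F (schurMul C C) ≤ Module.finrank F (schurMul D D) := by
  obtain ⟨π, v, -, hCD⟩ := h
  let φ : (Fin N → F) →ₗ[F] (Fin N → F) :=
    LinearMap.pi fun i => (v i * v i) • LinearMap.proj (π i)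
  have hle : schurMul C C ≤ (schurMul D D).map φ := by
    refine Submodule.span_le.2 ?_
    rintro x ⟨c, hc, c', hc', rfl⟩
    rw [← SetLike.mem_coe, hCD] at hc hc'
    obtain ⟨y, hy, rfl⟩ := hc
    obtain ⟨y', hy', rfl⟩ := hc'
    refine ⟨y * y', Submodule.subset_span ⟨y, hy, y', hy', rfl⟩, ?_⟩
    ext i
    simp [φ]
    ring
  exact (Submodule.finrank_mono hle).trans (Submodule.finrank_map_le φ _)

lemma finrank_schurMul_map_degreeLT_le {N d : ℕ} (e e' : F[X] →ₗ[F] (Fin N → F))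
    (h : ∀ f ∈ degreeLT F (d + 1), ∀ g ∈ degreeLT F (d + 1), e f * e g = e' (f * g)) :
    Module.finrank F (schurMul ((degreeLT F (d + 1)).map e) ((degreeLT F (d + 1)).map e)) ≤
      d + d + 1 := by
  have hle : schurMul ((degreeLT F (d + 1)).map e) ((degreeLT F (d + 1)).map e) ≤
      (degreeLT F (d + d + 1)).map e' := by
    refine Submodule.span_le.2 ?_
    rintro x ⟨c, ⟨f, hf, rfl⟩, c', ⟨g, hg, rfl⟩, rfl⟩
    exact ⟨f * g, mul_mem_degreeLT hf hg, (h f hf g hg).symm⟩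
  refine (Submodule.finrank_mono hle).trans ((Submodule.finrank_map_le e' _).trans ?_)
  rw [finrank_degreeLT]

lemma span_eq_map_degreeLT {N k : ℕ} (e : F[X] →ₗ[F] (Fin N → F)) :
    Submodule.span F {x | ∃ f : F[X], f.degree < (k : WithBot ℕ) ∧ x = e f} =
      (degreeLT F k).map e := by
  rw [← Submodule.span_eq ((degreeLT F k).map e)]
  congr 1
  ext x
  simp [mem_degreeLT, eq_comm]

lemma finrank_schurMul_RSCode_le {N d : ℕ} (a : Fin N → F) :
    Module.finrank F (schurMul (RSCode (d + 1) N a) (RSCode (d + 1) N a)) ≤ d + d + 1 := by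
  let e : F[X] →ₗ[F] (Fin N → F) := LinearMap.pi fun j => leval (a j)
  have hC : RSCode (d + 1) N a = (degreeLT F (d + 1)).map e := span_eq_map_degreeLT e
  rw [hC]
  refine finrank_schurMul_map_degreeLT_le e e fun f _ g _ => ?_
  ext j
  simp [e]

/-- Evaluation of polynomials at the points `a`, followed by the coefficient of degree `s`. -/
noncomputable def extEval {N : ℕ} (a : Fin (N - 1) → F) (s : ℕ) : F[X] →ₗ[F] (Fin N → F) :=
  LinearMap.pi fun j => if h : (j : ℕ) < N - 1 then leval (a ⟨j, h⟩) else lcoeff F s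

lemma extEval_apply {N : ℕ} (a : Fin (N - 1) → F) (s : ℕ) (f : F[X]) :
    extEval a s f = fun j : Fin N =>
      if h : (j : ℕ) < N - 1 then f.eval (a ⟨j, h⟩) else f.coeff s := by
  ext j
  simp only [extEval, LinearMap.pi_apply]
  split_ifs <;> simp

lemma finrank_schurMul_RSextCode_le {N d : ℕ} (a : Fin (N - 1) → F) :
    Module.finrank F (schurMul (RSextCode (d + 1) N a) (RSextCode (d + 1) N a)) ≤ d + d + 1 := by
  have hC : RSextCode (d + 1) N a = (degreeLT F (d + 1)).map (extEval a d) := by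
    rw [← span_eq_map_degreeLT]
    simp only [extEval_apply]
    rfl
  rw [hC]
  refine finrank_schurMul_map_degreeLT_le _ (extEval a (d + d)) fun f hf g hg => ?_
  ext j
  simp only [extEval_apply, Pi.mul_apply]
  split_ifs
  · simp
  · exact (coeff_add_mul_of_mem_degreeLT hf hg).symm

end SchurSquare

section TwistedCode

variable {F : Type*} [Field F] {m : ℕ}

/-- Evaluation at the points `a`, with two twisted coordinates `f₀ - l₁ f_d` and `f₀ - l₂ f_d`. -/
noncomputable def twistedEval (d : ℕ) (a : Fin m → F) (l₁ l₂ : F) :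
    F[X] →ₗ[F] (Fin (m + 2) → F) :=
  LinearMap.pi (Fin.cons (lcoeff F 0 - l₁ • lcoeff F d)
    (Fin.cons (lcoeff F 0 - l₂ • lcoeff F d) fun j => leval (a j)))

/-- The linear map through which products of values of `twistedEval` factor. -/
noncomputable def twistedSqEval (d : ℕ) (a : Fin m → F) (l₁ l₂ : F) :
    F[X] × F →ₗ[F] (Fin (m + 2) → F) :=
  LinearMap.pi (Fin.cons
    ((lcoeff F 0 + l₁ ^ 2 • lcoeff F (d + d)) ∘ₗ LinearMap.fst F F[X] F -
      l₁ • LinearMap.snd F F[X] F)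
    (Fin.cons
      ((lcoeff F 0 + l₂ ^ 2 • lcoeff F (d + d)) ∘ₗ LinearMap.fst F F[X] F -
        l₂ • LinearMap.snd F F[X] F)
      fun j => leval (a j) ∘ₗ LinearMap.fst F F[X] F))

/-- The code of evaluations of polynomials of degree at most `d` under `twistedEval`. -/
noncomputable def twistedCode (d : ℕ) (a : Fin m → F) (l₁ l₂ : F) :
    Submodule F (Fin (m + 2) → F) :=
  (degreeLT F (d + 1)).map (twistedEval d a l₁ l₂)

variable (d : ℕ) (a : Fin m → F) (l₁ l₂ : F)

@[simp] lemma twistedEval_zero (f : F[X]) :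
    twistedEval d a l₁ l₂ f 0 = f.coeff 0 - l₁ * f.coeff d := by
  simp [twistedEval]

@[simp] lemma twistedEval_one (f : F[X]) :
    twistedEval d a l₁ l₂ f (Fin.succ 0) = f.coeff 0 - l₂ * f.coeff d := by
  simp only [twistedEval, LinearMap.pi_apply, Fin.cons_succ, Fin.cons_zero]
  simp

@[simp] lemma twistedEval_succ_succ (f : F[X]) (j : Fin m) :
    twistedEval d a l₁ l₂ f j.succ.succ = f.eval (a j) := by
  simp [twistedEval]

@[simp] lemma twistedSqEval_zero (x : F[X] × F) :
    twistedSqEval d a l₁ l₂ x 0 = x.1.coeff 0 + l₁ ^ 2 * x.1.coeff (d + d) - l₁ * x.2 := by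
  simp [twistedSqEval]

@[simp] lemma twistedSqEval_one (x : F[X] × F) :
    twistedSqEval d a l₁ l₂ x (Fin.succ 0) =
      x.1.coeff 0 + l₂ ^ 2 * x.1.coeff (d + d) - l₂ * x.2 := by
  simp only [twistedSqEval, LinearMap.pi_apply, Fin.cons_succ, Fin.cons_zero]
  simp

@[simp] lemma twistedSqEval_succ_succ (x : F[X] × F) (j : Fin m) :
    twistedSqEval d a l₁ l₂ x j.succ.succ = x.1.eval (a j) := by
  simp [twistedSqEval]

variable {d}

lemma twistedEval_mul {f g : F[X]} (hf : f ∈ degreeLT F (d + 1)) (hg : g ∈ degreeLT F (d + 1)) :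
    twistedEval d a l₁ l₂ f * twistedEval d a l₁ l₂ g =
      twistedSqEval d a l₁ l₂ (f * g, f.coeff 0 * g.coeff d + f.coeff d * g.coeff 0) := by
  ext j
  have h := coeff_add_mul_of_mem_degreeLT hf hg
  refine Fin.cases ?_ (Fin.cases ?_ fun j => ?_) j
  · simp only [Pi.mul_apply, twistedEval_zero, twistedSqEval_zero, h, mul_coeff_zero]
    ring
  · simp only [Pi.mul_apply, twistedEval_one, twistedSqEval_one, h, mul_coeff_zero]
    ring
  · simp

lemma schurMul_twistedCode (hd : 2 ≤ d) :
    schurMul (twistedCode d a l₁ l₂) (twistedCode d a l₁ l₂) =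
      ((degreeLT F (d + d + 1)).prod ⊤).map (twistedSqEval d a l₁ l₂) := by
  classical
  refine le_antisymm (Submodule.span_le.2 ?_) (Submodule.map_le_iff_le_comap.2 ?_)
  · rintro x ⟨c, ⟨f, hf, rfl⟩, c', ⟨g, hg, rfl⟩, rfl⟩
    rw [twistedEval_mul a l₁ l₂ hf hg]
    exact ⟨_, ⟨mul_mem_degreeLT hf hg, trivial⟩, rfl⟩
  set T := (schurMul (twistedCode d a l₁ l₂) (twistedCode d a l₁ l₂)).comap
    (twistedSqEval d a l₁ l₂)
  have hX : ∀ i ≤ d, (X ^ i : F[X]) ∈ degreeLT F (d + 1) := fun i hi =>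
    mem_degreeLT_of_natDegree_le (by simpa using hi)
  have hXX : ∀ i ≤ d, ∀ j ≤ d, ((X ^ i * X ^ j : F[X]),
      (X ^ i : F[X]).coeff 0 * (X ^ j : F[X]).coeff d +
        (X ^ i : F[X]).coeff d * (X ^ j : F[X]).coeff 0) ∈ T := by
    intro i hi j hj
    refine Submodule.subset_span ⟨_, ⟨_, hX i hi, rfl⟩, _, ⟨_, hX j hj, rfl⟩, ?_⟩
    rw [twistedEval_mul a l₁ l₂ (hX i hi) (hX j hj)]
  have hmono : ∀ s < d + d + 1, ((X ^ s : F[X]), (0 : F)) ∈ T := by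
    intro s hs
    rcases lt_trichotomy s d with h | h | h
    · have := hXX 0 (by omega) s (by omega)
      simpa [coeff_X_pow, coeff_one, h.ne', show d ≠ 0 by omega] using this
    · have := hXX 1 (by omega) (d - 1) (by omega)
      rw [← pow_add, show 1 + (d - 1) = s by omega] at this
      simpa [coeff_X_pow, show 0 ≠ d - 1 by omega, show d ≠ d - 1 by omega,
        show d ≠ 1 by omega] using this
    · have := hXX d le_rfl (s - d) (by omega)
      rw [← pow_add, show d + (s - d) = s by omega] at this
      simpa [coeff_X_pow, show 0 ≠ d by omega, show 0 ≠ s - d by omega] using this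
  have hpoly : degreeLT F (d + d + 1) ≤ T.comap (LinearMap.inl F F[X] F) := by
    rw [degreeLT_eq_span_X_pow, Submodule.span_le]
    intro x hx
    simp only [coe_image, Set.mem_image, SetLike.mem_coe, Finset.mem_range] at hx
    obtain ⟨s, hs, rfl⟩ := hx
    exact hmono s hs
  have hone : ((0 : F[X]), (1 : F)) ∈ T := by
    have h1 := hXX 0 (by omega) d le_rfl
    have h2 := hmono d (by omega)
    have h3 := T.sub_mem h1 h2
    simpa [coeff_X_pow, coeff_one, show d ≠ 0 by omega, show 0 ≠ d by omega] using h3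
  rintro ⟨h, w⟩ ⟨hh, -⟩
  have h1 : (h, (0 : F)) ∈ T := hpoly hh
  have h2 := T.add_mem h1 (T.smul_mem w hone)
  simpa using h2

variable {a l₁ l₂}

lemma twistedSqEval_injOn (ha : Function.Injective a) (hl : l₁ ≠ l₂) (hl₁ : l₁ ≠ 0)
    {I : Finset (Fin m)} (hI : #I = d + d) (hP : l₁ * l₂ ≠ ∏ i ∈ I, a i)
    {x : F[X] × F} (hx : x.1 ∈ degreeLT F (d + d + 1)) (h0 : twistedSqEval d a l₁ l₂ x = 0) :
    x = 0 := by
  obtain ⟨h, w⟩ := x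
  have e0 := congr_fun h0 0
  have e1 := congr_fun h0 (Fin.succ 0)
  rw [twistedSqEval_zero] at e0
  rw [twistedSqEval_one] at e1
  simp only [Pi.zero_apply] at e0 e1
  have hev : ∀ i ∈ I, h.eval (a i) = 0 := fun i _ => by
    simpa using congr_fun h0 i.succ.succ
  have hdeg : h.natDegree ≤ #I := hI ▸ natDegree_le_of_mem_degreeLT hx
  have hc := coeff_zero_of_vanishing ha I hdeg hev
  rw [hI, ← two_mul, pow_mul, neg_one_sq, one_pow, one_mul, two_mul] at hc
  have key : (l₂ - l₁) * (∏ i ∈ I, a i - l₁ * l₂) * h.coeff (d + d) = 0 := by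
    linear_combination l₂ * e0 - l₁ * e1 - (l₂ - l₁) * hc
  have hlead : h.coeff (d + d) = 0 := by
    refine (mul_eq_zero.1 key).resolve_left (mul_ne_zero (sub_ne_zero.2 hl.symm) ?_)
    exact sub_ne_zero.2 hP.symm
  have hh : h = 0 := by
    rw [eq_C_mul_prod_of_vanishing ha I hdeg hev, hI, hlead]
    simp
  subst hh
  have hw : w = 0 := by simpa [hl₁] using e0
  rw [hw]
  rfl

lemma finrank_schurMul_twistedCode (hd : 2 ≤ d) (ha : Function.Injective a) (hl : l₁ ≠ l₂)
    (hl₁ : l₁ ≠ 0) {I : Finset (Fin m)} (hI : #I = d + d) (hP : l₁ * l₂ ≠ ∏ i ∈ I, a i) :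
    Module.finrank F (schurMul (twistedCode d a l₁ l₂) (twistedCode d a l₁ l₂)) =
      2 * (d + 1) := by
  let ψ : (degreeLT F (d + d + 1)) × F →ₗ[F] (Fin (m + 2) → F) :=
    twistedSqEval d a l₁ l₂ ∘ₗ LinearMap.prodMap (degreeLT F (d + d + 1)).subtype LinearMap.id
  have hψ : Function.Injective ψ := by
    rw [← LinearMap.ker_eq_bot, LinearMap.ker_eq_bot']
    rintro ⟨h, w⟩ h0
    have := twistedSqEval_injOn ha hl hl₁ hI hP (x := (h, w)) h.2 h0
    simpa [Prod.ext_iff] using this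
  have hrange : schurMul (twistedCode d a l₁ l₂) (twistedCode d a l₁ l₂) = LinearMap.range ψ := by
    rw [schurMul_twistedCode a l₁ l₂ hd, LinearMap.range_comp, LinearMap.range_prodMap]
    simp
  rw [hrange, LinearMap.finrank_range_of_inj hψ, Module.finrank_prod, finrank_degreeLT,
    Module.finrank_self]
  ring

variable [DecidableEq F]

lemma hammingNorm_twistedEval (f : F[X]) :
    hammingNorm (twistedEval d a l₁ l₂ f) =
      (if f.coeff 0 - l₁ * f.coeff d ≠ 0 then 1 else 0) +
        (if f.coeff 0 - l₂ * f.coeff d ≠ 0 then 1 else 0) + #{j | f.eval (a j) ≠ 0} := by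
  rw [hammingNorm, Fin.card_filter_univ_succ, Fin.card_filter_univ_succ]
  simp only [twistedEval_zero, twistedEval_one, twistedEval_succ_succ]
  split_ifs <;> omega

lemma le_hammingNorm_twistedEval (ha : Function.Injective a) (ha0 : ∀ i, a i ≠ 0)
    (hl : l₁ ≠ l₂) (hP₁ : ∀ I : Finset (Fin m), l₁ ≠ (-1) ^ d * ∏ i ∈ I, a i)
    (hP₂ : ∀ I : Finset (Fin m), l₂ ≠ (-1) ^ d * ∏ i ∈ I, a i)
    {f : F[X]} (hf : f ∈ degreeLT F (d + 1)) (hf0 : f ≠ 0) :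
    m + 2 ≤ hammingNorm (twistedEval d a l₁ l₂ f) + d := by
  have hdeg := natDegree_le_of_mem_degreeLT hf
  have hcard : #{j | f.eval (a j) = 0} + #{j | f.eval (a j) ≠ 0} = m := by
    simpa using Finset.card_filter_add_card_filter_not (s := (univ : Finset (Fin m)))
      (fun j => f.eval (a j) = 0)
  rw [hammingNorm_twistedEval]
  set Z : Finset (Fin m) := {j | f.eval (a j) = 0} with hZ
  have hmem : ∀ j, j ∈ Z ↔ f.eval (a j) = 0 := by simp [hZ]
  by_cases h1 : d ≤ #Z
  · obtain ⟨I, hIZ, hI⟩ := Finset.exists_subset_card_eq h1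
    have hev : ∀ i ∈ I, f.eval (a i) = 0 := fun i hi => (hmem i).1 (hIZ hi)
    have hprod := eq_C_mul_prod_of_vanishing ha I (hI ▸ hdeg) hev
    have hc := coeff_zero_of_vanishing ha I (hI ▸ hdeg) hev
    rw [hI] at hprod hc
    have hlead : f.coeff d ≠ 0 := fun h => hf0 (by rw [hprod, h]; simp)
    have hZI : Z ⊆ I := by
      intro j hj
      have h2 := (hmem j).1 hj
      rw [hprod, eval_mul, eval_C, eval_prod] at h2
      obtain ⟨i, hi, h3⟩ := Finset.prod_eq_zero_iff.1 ((mul_eq_zero.1 h2).resolve_left hlead)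
      have : a j = a i := by simpa [sub_eq_zero] using h3
      rwa [ha this]
    have hle := Finset.card_le_card hZI
    have hne : ∀ l : F, (∀ I : Finset (Fin m), l ≠ (-1) ^ d * ∏ i ∈ I, a i) →
        f.coeff 0 - l * f.coeff d ≠ 0 := by
      intro l hP h
      refine hP I (mul_right_cancel₀ hlead ?_)
      linear_combination hc - h
    rw [if_pos (hne l₁ hP₁), if_pos (hne l₂ hP₂)]
    omega
  by_cases h2 : #Z + 1 = d
  · have hnot : ¬ (f.coeff 0 - l₁ * f.coeff d = 0 ∧ f.coeff 0 - l₂ * f.coeff d = 0) := by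
      rintro ⟨e1, e2⟩
      have hlead : f.coeff d = 0 := by
        have : (l₂ - l₁) * f.coeff d = 0 := by linear_combination e1 - e2
        exact (mul_eq_zero.1 this).resolve_left (sub_ne_zero.2 hl.symm)
      have h00 : f.coeff 0 = 0 := by simpa [hlead] using e1
      have hdeg' : f.natDegree ≤ #Z := by
        rw [natDegree_le_iff_coeff_eq_zero] at hdeg ⊢
        intro N hN
        rcases (show d ≤ N by omega).eq_or_lt with rfl | h
        · exact hlead
        · exact hdeg N h
      have hev : ∀ i ∈ Z, f.eval (a i) = 0 := fun i hi => (hmem i).1 hi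
      have hc := coeff_zero_of_vanishing ha Z hdeg' hev
      rw [h00, eq_comm] at hc
      have hlead' := (mul_eq_zero.1 hc).resolve_right
        (mul_ne_zero (by simp) (Finset.prod_ne_zero_iff.2 fun i _ => ha0 i))
      exact hf0 (by rw [eq_C_mul_prod_of_vanishing ha Z hdeg' hev, hlead']; simp)
    split_ifs <;> first | omega | (exfalso; simp_all)
  · omega

lemma exists_hammingNorm_twistedEval_le (hd : d ≤ m) :
    ∃ f ∈ degreeLT F (d + 1), f ≠ 0 ∧ hammingNorm (twistedEval d a l₁ l₂ f) + d ≤ m + 2 := by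
  obtain ⟨I, -, hI⟩ := Finset.exists_subset_card_eq (s := (univ : Finset (Fin m))) (n := d)
    (by simpa using hd)
  have hmonic : (∏ i ∈ I, (X - C (a i))).Monic := monic_prod_of_monic _ _ fun i _ => monic_X_sub_C _
  refine ⟨∏ i ∈ I, (X - C (a i)), mem_degreeLT_of_natDegree_le ?_, hmonic.ne_zero, ?_⟩
  · rw [natDegree_prod_of_monic _ _ fun i _ => monic_X_sub_C _]
    simp [hI]
  · rw [hammingNorm_twistedEval]
    have hsub : ({j | (∏ i ∈ I, (X - C (a i))).eval (a j) ≠ 0} : Finset (Fin m)) ⊆ Iᶜ := by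
      intro j hj
      simp only [Finset.mem_filter, Finset.mem_univ, true_and] at hj
      rw [Finset.mem_compl]
      intro hjI
      exact hj (by rw [eval_prod]; exact Finset.prod_eq_zero hjI (by simp))
    have hle := Finset.card_le_card hsub
    rw [Finset.card_compl, hI, Fintype.card_fin] at hle
    split_ifs <;> omega

end TwistedCode

section Squares

variable {F : Type*} [Field F] [Fintype F] [DecidableEq F]

lemma card_le_two_mul_card_image_sq :
    Fintype.card F - 1 ≤ 2 * #((univ.erase (0 : F)).image fun x => x ^ 2) := by
  have h := Finset.card_le_mul_card_image (f := fun x : F => x ^ 2) (univ.erase (0 : F)) 2 ?_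
  · rwa [Finset.card_erase_of_mem (Finset.mem_univ _), Finset.card_univ] at h
  intro b hb
  obtain ⟨y, -, rfl⟩ := Finset.mem_image.1 hb
  refine (Finset.card_le_card (t := {y, -y}) ?_).trans Finset.card_le_two
  intro x hx
  simpa [sq_eq_sq_iff_eq_or_eq_neg] using (Finset.mem_filter.1 hx).2

lemma exists_injective_isSquare {m : ℕ} (hm : 2 * m ≤ Fintype.card F - 1) :
    ∃ a : Fin m → F, Function.Injective a ∧ ∀ i, a i ≠ 0 ∧ IsSquare (a i) := by
  have hle : m ≤ #((univ.erase (0 : F)).image fun x => x ^ 2) := by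
    have := card_le_two_mul_card_image_sq (F := F)
    omega
  obtain ⟨S, hS, hcard⟩ := Finset.exists_subset_card_eq hle
  refine ⟨fun i => S.equivFin.symm (i.cast hcard.symm), ?_, fun i => ?_⟩
  · exact Subtype.val_injective.comp (S.equivFin.symm.injective.comp (Fin.cast_injective _))
  · obtain ⟨y, hy, h⟩ := Finset.mem_image.1 (hS (S.equivFin.symm (i.cast hcard.symm)).2)
    beta_reduce
    rw [← h]
    exact ⟨pow_ne_zero 2 (Finset.ne_of_mem_erase hy), IsSquare.sq y⟩

lemma exists_nonsquare_pair (hF : ringChar F ≠ 2) (hcard : 6 ≤ Fintype.card F) (P : F) :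
    ∃ u v : F, ¬ IsSquare u ∧ ¬ IsSquare v ∧ u ≠ v ∧ u * v ≠ P := by
  obtain ⟨u, hu⟩ := FiniteField.exists_nonsquare hF
  have hu0 : u ≠ 0 := fun h => hu (h ▸ IsSquare.zero)
  obtain ⟨s, hs, hs'⟩ : ∃ s ∈ (univ.erase (0 : F)).image fun x => x ^ 2,
      s ∉ ({1, P / (u * u)} : Finset F) := by
    refine Finset.exists_mem_notMem_of_card_lt_card (Finset.card_le_two.trans_lt ?_)
    have := card_le_two_mul_card_image_sq (F := F)
    omega
  obtain ⟨y, hy, rfl⟩ := Finset.mem_image.1 hs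
  have hy0 : y ≠ 0 := Finset.ne_of_mem_erase hy
  simp only [Finset.mem_insert, Finset.mem_singleton, not_or] at hs'
  refine ⟨u, u * y ^ 2, hu, ?_, ?_, ?_⟩
  · rintro ⟨z, hz⟩
    exact hu ⟨z / y, by field_simp; linear_combination hz⟩
  · intro h
    exact hs'.1 (mul_left_cancel₀ hu0 (by rw [← h, mul_one]))
  · intro h
    exact hs'.2 (by rw [eq_div_iff (mul_ne_zero hu0 hu0), ← h]; ring)

end Squares

end TwistedRS

/-- For an odd prime power `q` and integers `n, k` with `3 ≤ k`,
`2k ≤ n`, `2n ≤ q + 3`, there is a linear code `C ⊆ F_q^n` of dimension `k` with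
minimum Hamming distance `n - k + 1` (an MDS code) whose Schur square has dimension
exactly `2k`; in particular `C` is not equivalent to any `k`-dimensional
Reed–Solomon or extended Reed–Solomon code over `F_q`. -/
theorem exists_MDS_nonRS_odd {F : Type*} [Field F] [Fintype F] [DecidableEq F]
    (q n k p r : ℕ) (hp : p.Prime) (hq : q = p ^ r) (hodd : Odd q)
    (hcard : Fintype.card F = q)
    (hk3 : 3 ≤ k) (hkn : 2 * k ≤ n) (hnq : 2 * n ≤ q + 3) :
    ∃ C : Submodule F (Fin n → F),
      Module.finrank F C = k ∧
      minDist C = n - k + 1 ∧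
      Module.finrank F (schurMul C C) = 2 * k ∧
      (∀ a' : Fin n → F, Function.Injective a' → ¬ codeEquiv C (RSCode k n a')) ∧
      (∀ a' : Fin (n - 1) → F, Function.Injective a' →
        ¬ codeEquiv C (RSextCode k n a')) := by
  obtain ⟨d, rfl⟩ : ∃ d, k = d + 1 := ⟨k - 1, by omega⟩
  obtain ⟨m, rfl⟩ : ∃ m, n = m + 2 := ⟨n - 2, by omega⟩
  have hF : ringChar F ≠ 2 := by
    rw [Ne, FiniteField.even_card_iff_char_two, hcard]
    have := Nat.odd_iff.1 hodd
    omega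
  obtain ⟨a, ha, haS⟩ := TwistedRS.exists_injective_isSquare (F := F) (m := m) (by omega)
  obtain ⟨I, -, hI⟩ := Finset.exists_subset_card_eq (s := (univ : Finset (Fin m))) (n := d + d)
    (by simp only [Finset.card_univ, Fintype.card_fin]; omega)
  obtain ⟨u, v, hu, hv, huv, hP⟩ :=
    TwistedRS.exists_nonsquare_pair hF (by omega) (∏ i ∈ I, a i)
  have hε : ((-1 : F) ^ d) * (-1) ^ d = 1 := by
    rw [← mul_pow]
    simp
  have hε0 : ((-1 : F) ^ d) ≠ 0 := by simp
  have hne : ∀ w : F, ¬ IsSquare w → ∀ J : Finset (Fin m),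
      (-1) ^ d * w ≠ (-1) ^ d * ∏ i ∈ J, a i := fun w hw J h =>
    hw (mul_left_cancel₀ hε0 h ▸ Finset.isSquare_prod a fun i _ => (haS i).2)
  have hl : (-1) ^ d * u ≠ (-1) ^ d * v := fun h => huv (mul_left_cancel₀ hε0 h)
  have hl0 : (-1) ^ d * u ≠ 0 := mul_ne_zero hε0 fun h => hu (h ▸ IsSquare.zero)
  have hlP : (-1) ^ d * u * ((-1) ^ d * v) ≠ ∏ i ∈ I, a i := by
    rwa [mul_mul_mul_comm, hε, one_mul]
  have hweight : ∀ f ∈ Polynomial.degreeLT F (d + 1), f ≠ 0 → m + 2 ≤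
      hammingNorm (TwistedRS.twistedEval d a ((-1) ^ d * u) ((-1) ^ d * v) f) + d :=
    fun f hf hf0 => TwistedRS.le_hammingNorm_twistedEval ha (fun i => (haS i).1) hl
      (hne u hu) (hne v hv) hf hf0
  have hfin := TwistedRS.finrank_schurMul_twistedCode (by omega) ha hl hl0 hI hlP
  refine ⟨TwistedRS.twistedCode d a ((-1) ^ d * u) ((-1) ^ d * v), ?_, ?_, hfin, ?_, ?_⟩
  · rw [TwistedRS.twistedCode, ← LinearMap.range_domRestrict, LinearMap.finrank_range_of_inj,
      TwistedRS.finrank_degreeLT]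
    rw [← LinearMap.ker_eq_bot, LinearMap.ker_eq_bot']
    rintro ⟨f, hf⟩ h0
    by_contra hf0
    have h := hweight f hf fun h => hf0 (Subtype.ext h)
    rw [LinearMap.domRestrict_apply] at h0
    rw [h0, hammingNorm_zero] at h
    omega
  · obtain ⟨f, hf, hf0, hle⟩ := TwistedRS.exists_hammingNorm_twistedEval_le (a := a) (d := d)
      (l₁ := (-1) ^ d * u) (l₂ := (-1) ^ d * v) (by omega)
    have hge := hweight f hf hf0
    refine IsLeast.csInf_eq ⟨⟨_, ⟨f, hf, rfl⟩, ?_, by omega⟩, ?_⟩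
    · intro h
      rw [h, hammingNorm_zero] at hge
      omega
    · rintro w ⟨x, ⟨g, hg, rfl⟩, hx, rfl⟩
      have := hweight g hg fun h => hx (by rw [h, map_zero])
      omega
  · intro a' _ h
    have h1 := TwistedRS.finrank_schurMul_le_of_codeEquiv h
    have h2 := TwistedRS.finrank_schurMul_RSCode_le (d := d) a'
    omega
  · intro a' _ h
    have h1 := TwistedRS.finrank_schurMul_le_of_codeEquiv h
    have h2 := TwistedRS.finrank_schurMul_RSextCode_le (d := d) a'
    omega
end

section
/- Let q = 2^{2m} for a positive integer m, and let n, k be integers with 3 ≤ k, 2k ≤ n, and 3n ≤ q + 8. Then there exists a linear code C ⊆ (F_q)^n of dimension k whose minimum Hamming distance equals n − k + 1 (i.e., C is MDS) and whose Schur square C^2 has dimension exactly 2k over F_q; in particular, C is not equivalent to any k-dimensional Reed–Solomon or extended Reed–Solomon code over F_q. -/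
open Matrix Finset

open Polynomial in
/-- A polynomial of degree at most `#s` vanishing on the nodes `a i`, `i ∈ s`, is a multiple of
the nodal polynomial. -/
theorem eq_C_mul_nodal {F ι : Type*} [Field F] {s : Finset ι} {a : ι → F} (ha : Set.InjOn a s)
    {f : F[X]} (hf : f.degree < (s.card + 1 : ℕ)) (h : ∀ i ∈ s, f.eval (a i) = 0) :
    f = C (f.coeff s.card) * Lagrange.nodal s a := by
  rw [← sub_eq_zero]
  refine Polynomial.eq_zero_of_degree_lt_of_eval_index_eq_zero _ ha ?_ ?_
  · rw [degree_lt_iff_coeff_zero]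
    intro m hm
    rw [coeff_sub, coeff_C_mul]
    rcases hm.eq_or_lt with rfl | hm
    · have h1 := (Lagrange.nodal_monic (s := s) (v := a)).coeff_natDegree
      rw [Lagrange.natDegree_nodal] at h1
      rw [h1, mul_one, sub_self]
    · rw [(degree_lt_iff_coeff_zero f _).1 hf m hm,
        coeff_eq_zero_of_natDegree_lt (p := Lagrange.nodal s a)
          (by rwa [Lagrange.natDegree_nodal]), mul_zero, sub_zero]
  · intro i hi
    rw [eval_sub, eval_mul, Lagrange.eval_nodal_at_node hi, h i hi, mul_zero, sub_self]

open Polynomial in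
/-- Evaluation of a polynomial at the nodes `a j`, where the coordinates in `T` are twisted:
there `f` is sent to `f_0 + a_j f_{k-1}`. -/
noncomputable def twistedEval {F : Type*} [Field F] {n : ℕ} (k : ℕ) (a : Fin n → F)
    (T : Finset (Fin n)) :
    F[X] →ₗ[F] (Fin n → F) :=
  LinearMap.pi fun j =>
    if j ∈ T then lcoeff F 0 + a j • lcoeff F (k - 1) else leval (a j)

open Polynomial in
theorem twistedEval_apply {F : Type*} [Field F] {n : ℕ} (k : ℕ) (a : Fin n → F)
    (T : Finset (Fin n)) (f : F[X]) (j : Fin n) :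
    twistedEval k a T f j =
      if j ∈ T then f.coeff 0 + a j * f.coeff (k - 1) else f.eval (a j) := by
  simp only [twistedEval, LinearMap.pi_apply]
  split_ifs <;> simp [leval_apply]

open Polynomial in
/-- The linear map through which products of values of `twistedEval` factor: a product `f * g`
contributes the polynomial `f * g` together with `f_0 g_{k-1} + f_{k-1} g_0`. -/
noncomputable def twistedSqEval {F : Type*} [Field F] {n : ℕ} (k : ℕ) (a : Fin n → F)
    (T : Finset (Fin n)) :
    F[X] × F →ₗ[F] (Fin n → F) :=
  LinearMap.pi fun j =>
    if j ∈ T then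
      (lcoeff F 0 + a j ^ 2 • lcoeff F (2 * k - 2)).coprod (a j • LinearMap.id)
    else (leval (a j)).coprod 0

open Polynomial in
theorem twistedSqEval_apply {F : Type*} [Field F] {n : ℕ} (k : ℕ) (a : Fin n → F)
    (T : Finset (Fin n)) (h : F[X] × F) (j : Fin n) :
    twistedSqEval k a T h j =
      if j ∈ T then h.1.coeff 0 + a j ^ 2 * h.1.coeff (2 * k - 2) + a j * h.2
      else h.1.eval (a j) := by
  simp only [twistedSqEval, LinearMap.pi_apply]
  split_ifs <;> simp [leval_apply]

open Polynomial in
/-- The top coefficient of a product of two polynomials of degree at most `k - 1`. -/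
theorem coeff_mul_two_mul_sub_two {F : Type*} [Field F] {k : ℕ} (hk : 1 ≤ k) {f g : F[X]}
    (hf : f.degree < k) (hg : g.degree < k) :
    (f * g).coeff (2 * k - 2) = f.coeff (k - 1) * g.coeff (k - 1) := by
  have hnat : ∀ p : F[X], p.degree < k → p.natDegree ≤ k - 1 := by
    intro p hp
    rcases eq_or_ne p 0 with rfl | hp0
    · simp
    · exact Nat.le_sub_one_of_lt ((natDegree_lt_iff_degree_lt hp0).2 hp)
  rw [show 2 * k - 2 = (k - 1) + (k - 1) by omega]
  exact coeff_mul_add_eq_of_natDegree_le (hnat f hf) (hnat g hg)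

open Polynomial in
theorem degree_mul_lt_two_mul_sub_one {F : Type*} [Field F] {k : ℕ} {f g : F[X]}
    (hf : f.degree < k) (hg : g.degree < k) : (f * g).degree < (2 * k - 1 : ℕ) := by
  rcases eq_or_ne f 0 with rfl | hf0
  · simp
  rcases eq_or_ne g 0 with rfl | hg0
  · simp
  rw [degree_eq_natDegree hf0] at hf
  rw [degree_eq_natDegree hg0] at hg
  rw [degree_mul, degree_eq_natDegree hf0, degree_eq_natDegree hg0]
  norm_cast at *
  omega

open Polynomial in
theorem twistedEval_mul {F : Type*} [Field F] {n k : ℕ} (hk : 1 ≤ k) (a : Fin n → F)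
    (T : Finset (Fin n)) {f g : F[X]} (hf : f.degree < k) (hg : g.degree < k) :
    twistedEval k a T f * twistedEval k a T g =
      twistedSqEval k a T
        (f * g, f.coeff 0 * g.coeff (k - 1) + f.coeff (k - 1) * g.coeff 0) := by
  ext j
  rw [Pi.mul_apply, twistedEval_apply, twistedEval_apply, twistedSqEval_apply]
  split_ifs
  · rw [coeff_mul_two_mul_sub_two hk hf hg, mul_coeff_zero]
    ring
  · rw [eval_mul]

/-- The image of the polynomials of degree less than `k` under `twistedEval`. -/
noncomputable def twistedCode {F : Type*} [Field F] {n : ℕ} (k : ℕ) (a : Fin n → F)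
    (T : Finset (Fin n)) :
    Submodule F (Fin n → F) :=
  (Polynomial.degreeLT F k).map (twistedEval k a T)

open Polynomial in
/-- A polynomial of degree less than `k` is determined by any `k` of its twisted evaluations. -/
theorem eq_zero_of_twistedEval_eq_zero {F : Type*} [Field F] {n k : ℕ} (hk : 2 ≤ k)
    {a : Fin n → F} {T : Finset (Fin n)} (ha : Function.Injective a) (ha0 : ∀ j, a j ≠ 0)
    (hT : T.card = 2)
    (hprod : ∀ Z : Finset (Fin n), Disjoint Z T → Z.card = k - 1 →
      ∀ t ∈ T, ∏ j ∈ Z, (-a j) + a t ≠ 0)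
    {f : F[X]} (hf : f.degree < k) {Z : Finset (Fin n)} (hZ : Z.card = k)
    (h : ∀ j ∈ Z, twistedEval k a T f j = 0) : f = 0 := by
  classical
  have hev : ∀ j ∈ Z \ T, f.eval (a j) = 0 := by
    intro j hj
    rw [mem_sdiff] at hj
    simpa [twistedEval_apply, hj.2] using h j hj.1
  have htw : ∀ j ∈ Z ∩ T, f.coeff 0 + a j * f.coeff (k - 1) = 0 := by
    intro j hj
    rw [mem_inter] at hj
    simpa [twistedEval_apply, hj.2] using h j hj.1
  have hcard := card_sdiff_add_card_inter Z T
  have hle : (Z ∩ T).card ≤ 2 := hT ▸ card_le_card inter_subset_right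
  rcases Nat.lt_or_ge 1 (Z ∩ T).card with h2 | h1
  · obtain ⟨i, hi, j, hj, hij⟩ := one_lt_card.1 h2
    have htop : f.coeff (k - 1) = 0 := by
      have : (a i - a j) * f.coeff (k - 1) = 0 := by linear_combination htw i hi - htw j hj
      exact (mul_eq_zero.1 this).resolve_left (sub_ne_zero.2 (ha.ne hij))
    have hbot : f.coeff 0 = 0 := by simpa [htop] using htw i hi
    have hnot : (0 : F) ∉ (Z \ T).image a := by
      simp only [mem_image, not_exists, not_and]
      exact fun x _ => ha0 x
    refine Polynomial.eq_zero_of_degree_lt_of_eval_finset_eq_zero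
      (insert 0 ((Z \ T).image a)) ?_ ?_
    · rw [card_insert_of_notMem hnot, card_image_of_injective _ ha, degree_lt_iff_coeff_zero]
      intro m hm
      rcases eq_or_ne m (k - 1) with rfl | hmk
      · exact htop
      · exact (degree_lt_iff_coeff_zero f k).1 hf m (by omega)
    · intro x hx
      rcases mem_insert.1 hx with rfl | hx
      · rw [← coeff_zero_eq_eval_zero, hbot]
      · obtain ⟨j, hj, rfl⟩ := mem_image.1 hx
        exact hev j hj
  rcases Nat.eq_zero_or_pos (Z ∩ T).card with h0 | h0
  · refine Polynomial.eq_zero_of_degree_lt_of_eval_index_eq_zero _ ha.injOn ?_ hev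
    rwa [show (Z \ T).card = k by omega]
  · obtain ⟨t, ht⟩ := card_pos.1 h0
    have hc : (Z \ T).card = k - 1 := by omega
    have hfe := eq_C_mul_nodal ha.injOn (f := f) (s := Z \ T)
      (by rwa [hc, show k - 1 + 1 = k by omega]) hev
    rw [hc] at hfe
    have hbot : f.coeff 0 = f.coeff (k - 1) * ∏ j ∈ Z \ T, (-a j) := by
      conv_lhs => rw [hfe]
      simp [coeff_zero_eq_eval_zero, Lagrange.eval_nodal]
    have hne := hprod (Z \ T) sdiff_disjoint hc t (mem_inter.1 ht).2
    have : f.coeff (k - 1) * (∏ j ∈ Z \ T, (-a j) + a t) = 0 := by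
      linear_combination htw t ht - hbot
    rw [(mul_eq_zero.1 this).resolve_right hne] at hfe
    simpa using hfe

open Polynomial in
theorem finrank_twistedCode {F : Type*} [Field F] {n k : ℕ} {a : Fin n → F} {T : Finset (Fin n)}
    (hkn : k ≤ n)
    (hMDS : ∀ f : F[X], f.degree < k → ∀ Z : Finset (Fin n), Z.card = k →
      (∀ j ∈ Z, twistedEval k a T f j = 0) → f = 0) :
    Module.finrank F (twistedCode k a T) = k := by
  obtain ⟨Z, -, hZ⟩ := exists_subset_card_eq (s := (univ : Finset (Fin n))) (n := k) (by simpa)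
  have hinj : Function.Injective ((twistedEval k a T).domRestrict (degreeLT F k)) := by
    rw [injective_iff_map_eq_zero]
    rintro ⟨f, hf⟩ h
    have h' : twistedEval k a T f = 0 := h
    exact Subtype.ext (hMDS f (mem_degreeLT.1 hf) Z hZ fun j _ => by rw [h']; rfl)
  rw [twistedCode, ← LinearMap.range_domRestrict, LinearMap.finrank_range_of_inj hinj,
    (degreeLTEquiv F k).finrank_eq, Module.finrank_fin_fun]

open Polynomial in
theorem minDist_twistedCode {F : Type*} [Field F] [DecidableEq F] {n k : ℕ} {a : Fin n → F}
    {T : Finset (Fin n)} (hk : 1 ≤ k) (hkn : k + 1 ≤ n) (hT : T.card = 2)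
    (hMDS : ∀ f : F[X], f.degree < k → ∀ Z : Finset (Fin n), Z.card = k →
      (∀ j ∈ Z, twistedEval k a T f j = 0) → f = 0) :
    minDist (twistedCode k a T) = n - k + 1 := by
  have hweight : ∀ x : Fin n → F,
      hammingNorm x + (univ.filter fun j => x j = 0).card = n := by
    intro x
    have := card_filter_add_card_filter_not (s := (univ : Finset (Fin n))) (fun j => x j = 0)
    rw [card_univ, Fintype.card_fin] at this
    simp only [hammingNorm, ne_eq]
    omega
  have hlow : ∀ f : F[X], f.degree < k → f ≠ 0 →
      n - k + 1 ≤ hammingNorm (twistedEval k a T f) := by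
    intro f hf hf0
    by_contra hlt
    have := hweight (twistedEval k a T f)
    obtain ⟨Z, hZs, hZ⟩ := exists_subset_card_eq
      (s := univ.filter fun j => twistedEval k a T f j = 0) (n := k) (by omega)
    exact hf0 (hMDS f hf Z hZ fun j hj => (mem_filter.1 (hZs hj)).2)
  have hTc : Tᶜ.card = n - 2 := by rw [card_compl, hT, Fintype.card_fin]
  obtain ⟨Z, hZs, hZ⟩ := exists_subset_card_eq (s := Tᶜ) (n := k - 1) (by omega)
  have hdeg : (Lagrange.nodal Z a).degree < k := by
    rw [Lagrange.degree_nodal, hZ]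
    exact_mod_cast (show k - 1 < k by omega)
  have hne := Lagrange.nodal_ne_zero (s := Z) (v := a)
  have hupper : hammingNorm (twistedEval k a T (Lagrange.nodal Z a)) ≤ n - k + 1 := by
    have hsub : Z ⊆ univ.filter fun j => twistedEval k a T (Lagrange.nodal Z a) j = 0 := by
      intro j hj
      have hjT : j ∉ T := mem_compl.1 (hZs hj)
      simp [twistedEval_apply, hjT, Lagrange.eval_nodal_at_node hj]
    have := card_le_card hsub
    have := hweight (twistedEval k a T (Lagrange.nodal Z a))
    omega
  have hmem : n - k + 1 ∈ {d | ∃ x ∈ twistedCode k a T, x ≠ 0 ∧ hammingNorm x = d} := by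
    have heq := le_antisymm hupper (hlow _ hdeg hne)
    refine ⟨_, Submodule.mem_map_of_mem (mem_degreeLT.2 hdeg), ?_, heq⟩
    rw [← hammingNorm_ne_zero_iff, heq]
    omega
  refine le_antisymm (Nat.sInf_le hmem) (le_csInf ⟨_, hmem⟩ ?_)
  rintro d ⟨x, hx, hx0, rfl⟩
  obtain ⟨f, hf, rfl⟩ := Submodule.mem_map.1 hx
  exact hlow f (mem_degreeLT.1 hf) (by rintro rfl; simp at hx0)

open Polynomial in
/-- The Schur square of a twisted code is the image of `twistedSqEval`. -/
theorem schurMul_twistedCode {F : Type*} [Field F] {n k : ℕ} (hk : 3 ≤ k) (a : Fin n → F)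
    (T : Finset (Fin n)) :
    schurMul (twistedCode k a T) (twistedCode k a T) =
      (twistedSqEval k a T ∘ₗ
        (degreeLT F (2 * k - 1)).subtype.prodMap (LinearMap.id : F →ₗ[F] F)).range := by
  apply le_antisymm
  · refine Submodule.span_le.2 ?_
    rintro _ ⟨_, hc, _, hd, rfl⟩
    obtain ⟨f, hf, rfl⟩ := Submodule.mem_map.1 hc
    obtain ⟨g, hg, rfl⟩ := Submodule.mem_map.1 hd
    rw [mem_degreeLT] at hf hg
    rw [twistedEval_mul (by omega) a T hf hg]
    exact ⟨(⟨f * g, mem_degreeLT.2 (degree_mul_lt_two_mul_sub_one hf hg)⟩, _), rfl⟩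
  · have hX : ∀ s t : ℕ, s < k → t < k → twistedSqEval k a T ((X ^ (s + t) : F[X]),
        (X ^ s : F[X]).coeff 0 * (X ^ t : F[X]).coeff (k - 1) +
          (X ^ s : F[X]).coeff (k - 1) * (X ^ t : F[X]).coeff 0) ∈
        schurMul (twistedCode k a T) (twistedCode k a T) := by
      intro s t hs ht
      have hs' : (X ^ s : F[X]).degree < k := by rw [degree_X_pow]; exact_mod_cast hs
      have ht' : (X ^ t : F[X]).degree < k := by rw [degree_X_pow]; exact_mod_cast ht
      rw [pow_add, ← twistedEval_mul (by omega) a T hs' ht']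
      exact Submodule.subset_span ⟨_, Submodule.mem_map_of_mem (mem_degreeLT.2 hs'), _,
        Submodule.mem_map_of_mem (mem_degreeLT.2 ht'), rfl⟩
    have hpoly : ∀ i < 2 * k - 1, twistedSqEval k a T ((X ^ i : F[X]), 0) ∈
        schurMul (twistedCode k a T) (twistedCode k a T) := by
      intro i hi
      rcases Nat.lt_trichotomy i (k - 1) with h | h | h
      · have := hX 0 i (by omega) (by omega)
        rw [coeff_X_pow, coeff_X_pow, coeff_X_pow, coeff_X_pow, if_neg (by omega : k - 1 ≠ i),
          if_neg (by omega : k - 1 ≠ 0), zero_add] at this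
        simpa using this
      · have := hX 1 (k - 2) (by omega) (by omega)
        rw [coeff_X_pow, coeff_X_pow, coeff_X_pow, coeff_X_pow, if_neg (by omega : 0 ≠ 1),
          if_neg (by omega : k - 1 ≠ 1), show 1 + (k - 2) = i by omega] at this
        simpa using this
      · have := hX (i - (k - 1)) (k - 1) (by omega) (by omega)
        rw [coeff_X_pow, coeff_X_pow, coeff_X_pow, coeff_X_pow,
          if_neg (by omega : 0 ≠ i - (k - 1)), if_neg (by omega : 0 ≠ k - 1),
          show i - (k - 1) + (k - 1) = i by omega] at this
        simpa using this
    have hone : twistedSqEval k a T ((0 : F[X]), 1) ∈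
        schurMul (twistedCode k a T) (twistedCode k a T) := by
      have h1 := hX 0 (k - 1) (by omega) (by omega)
      rw [coeff_X_pow, coeff_X_pow, coeff_X_pow, coeff_X_pow,
        if_neg (by omega : k - 1 ≠ 0), zero_add] at h1
      have h2 := Submodule.sub_mem _ h1 (hpoly (k - 1) (by omega))
      rw [← map_sub] at h2
      simpa using h2
    rintro _ ⟨⟨⟨h, hh⟩, c⟩, rfl⟩
    change twistedSqEval k a T (h, c) ∈ _
    have hsplit : (h, c) = LinearMap.inl F F[X] F h + c • ((0 : F[X]), (1 : F)) := by simp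
    rw [hsplit, map_add, map_smul]
    refine Submodule.add_mem _ ?_ (Submodule.smul_mem _ _ hone)
    have hle : degreeLT F (2 * k - 1) ≤
        (schurMul (twistedCode k a T) (twistedCode k a T)).comap
          (twistedSqEval k a T ∘ₗ LinearMap.inl F F[X] F) := by
      classical
      rw [degreeLT_eq_span_X_pow, Submodule.span_le]
      intro x hx
      simp only [coe_image, coe_range, Set.mem_image, Set.mem_Iio] at hx
      obtain ⟨i, hi, rfl⟩ := hx
      exact hpoly i hi
    exact hle hh

open Polynomial in
theorem finrank_schurMul_twistedCode {F : Type*} [Field F] {n k : ℕ} (hk : 3 ≤ k)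
    (hkn : 2 * k ≤ n) {a : Fin n → F} {T : Finset (Fin n)} (ha : Function.Injective a)
    (ha0 : ∀ j, a j ≠ 0) (hT : T.card = 2) (hprod : ∏ j ∈ Tᶜ, a j ≠ ∏ j ∈ T, a j) :
    Module.finrank F (schurMul (twistedCode k a T) (twistedCode k a T)) = 2 * k := by
  obtain ⟨u, v, huv, rfl⟩ := card_eq_two.1 hT
  have hTc : ({u, v}ᶜ : Finset (Fin n)).card = n - 2 := by
    rw [card_compl, hT, Fintype.card_fin]
  have hinj : Function.Injective (twistedSqEval k a {u, v} ∘ₗ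
      (degreeLT F (2 * k - 1)).subtype.prodMap (LinearMap.id : F →ₗ[F] F)) := by
    rw [injective_iff_map_eq_zero]
    rintro ⟨⟨h, hh⟩, c⟩ h0
    have h0' : twistedSqEval k a {u, v} (h, c) = 0 := h0
    have hdeg : h.degree < (2 * k - 1 : ℕ) := mem_degreeLT.1 hh
    have hev : ∀ j ∈ ({u, v}ᶜ : Finset (Fin n)), h.eval (a j) = 0 := by
      intro j hj
      simpa [twistedSqEval_apply, mem_compl.1 hj] using congrFun h0' j
    have hu : h.coeff 0 + a u ^ 2 * h.coeff (2 * k - 2) + a u * c = 0 := by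
      simpa [twistedSqEval_apply] using congrFun h0' u
    have hv : h.coeff 0 + a v ^ 2 * h.coeff (2 * k - 2) + a v * c = 0 := by
      simpa [twistedSqEval_apply] using congrFun h0' v
    have hzero : h = 0 := by
      rcases hkn.eq_or_lt with hn | hn
      · have hcard : ({u, v}ᶜ : Finset (Fin n)).card = 2 * k - 2 := by omega
        have hhe := eq_C_mul_nodal ha.injOn (f := h) (s := {u, v}ᶜ)
          (by rwa [hcard, show 2 * k - 2 + 1 = 2 * k - 1 by omega]) hev
        rw [hcard] at hhe
        have hbot : h.coeff 0 = h.coeff (2 * k - 2) * ∏ j ∈ ({u, v}ᶜ : Finset (Fin n)), a j := by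
          conv_lhs => rw [hhe]
          rw [coeff_zero_eq_eval_zero, eval_mul, eval_C, Lagrange.eval_nodal]
          simp only [zero_sub, prod_neg, hcard]
          rw [Even.neg_one_pow ⟨k - 1, by omega⟩, one_mul]
        rw [prod_pair huv] at hprod
        have hne := sub_ne_zero.2 (ha.ne huv)
        have hzc : (a u - a v) * (h.coeff (2 * k - 2) *
            (∏ j ∈ ({u, v}ᶜ : Finset (Fin n)), a j - a u * a v)) = 0 := by
          linear_combination a u * hv - a v * hu - (a u - a v) * hbot
        have htop := (mul_eq_zero.1 ((mul_eq_zero.1 hzc).resolve_left hne)).resolve_right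
          (sub_ne_zero.2 hprod)
        rw [htop] at hhe
        simpa using hhe
      · refine Polynomial.eq_zero_of_degree_lt_of_eval_index_eq_zero _ ha.injOn
          (hdeg.trans_le ?_) hev
        rw [hTc]
        exact_mod_cast (show 2 * k - 1 ≤ n - 2 by omega)
    subst hzero
    have hc0 : c = 0 := by simpa [ha0 u] using hu
    subst hc0
    rfl
  have hfin : Module.Finite F (degreeLT F (2 * k - 1)) :=
    Module.Finite.equiv (degreeLTEquiv F (2 * k - 1)).symm
  rw [schurMul_twistedCode hk, LinearMap.finrank_range_of_inj hinj, Module.finrank_prod,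
    (degreeLTEquiv F _).finrank_eq, Module.finrank_fin_fun, Module.finrank_self]
  omega

open Polynomial in
/-- The Schur square of a code parametrized by polynomials of degree less than `k`, for which
products factor through the product polynomial, has dimension at most `2k - 1`. -/
theorem finrank_schurMul_span_le {F : Type*} [Field F] {n k : ℕ} (E : F[X] → Fin n → F)
    (L : F[X] →ₗ[F] (Fin n → F))
    (hE : ∀ f g : F[X], f.degree < k → g.degree < k → E f * E g = L (f * g))
    {D : Submodule F (Fin n → F)}
    (hD : ∀ x ∈ D, ∃ f : F[X], f.degree < k ∧ x = E f) :
    Module.finrank F (schurMul D D) ≤ 2 * k - 1 := by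
  have hle : schurMul D D ≤ (degreeLT F (2 * k - 1)).map L := by
    refine Submodule.span_le.2 ?_
    rintro _ ⟨_, hc, _, hd, rfl⟩
    obtain ⟨f, hf, rfl⟩ := hD _ hc
    obtain ⟨g, hg, rfl⟩ := hD _ hd
    rw [hE f g hf hg]
    exact Submodule.mem_map_of_mem (mem_degreeLT.2 (degree_mul_lt_two_mul_sub_one hf hg))
  have hfin : Module.Finite F (degreeLT F (2 * k - 1)) :=
    Module.Finite.equiv (degreeLTEquiv F (2 * k - 1)).symm
  calc Module.finrank F (schurMul D D)
      ≤ Module.finrank F ((degreeLT F (2 * k - 1)).map L) := Submodule.finrank_mono hle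
    _ ≤ Module.finrank F (degreeLT F (2 * k - 1)) := Submodule.finrank_map_le L _
    _ = 2 * k - 1 := by rw [(degreeLTEquiv F _).finrank_eq, Module.finrank_fin_fun]

open Polynomial in
theorem finrank_schurMul_RSCode_le {F : Type*} [Field F] {n k : ℕ} (a : Fin n → F) :
    Module.finrank F (schurMul (RSCode k n a) (RSCode k n a)) ≤ 2 * k - 1 := by
  let L : F[X] →ₗ[F] (Fin n → F) := LinearMap.pi fun j => leval (a j)
  refine finrank_schurMul_span_le (k := k) L L (fun f g _ _ => ?_) fun x hx => ?_
  · ext j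
    simp [L, leval_apply]
  · have hle : RSCode k n a ≤ (degreeLT F k).map L := by
      refine Submodule.span_le.2 ?_
      rintro _ ⟨f, hf, rfl⟩
      exact ⟨f, mem_degreeLT.2 hf, rfl⟩
    obtain ⟨f, hf, rfl⟩ := hle hx
    exact ⟨f, mem_degreeLT.1 hf, rfl⟩

open Polynomial in
theorem finrank_schurMul_RSextCode_le {F : Type*} [Field F] {n k : ℕ} (hk : 1 ≤ k)
    (a : Fin (n - 1) → F) :
    Module.finrank F (schurMul (RSextCode k n a) (RSextCode k n a)) ≤ 2 * k - 1 := by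
  let L : ℕ → F[X] →ₗ[F] (Fin n → F) := fun d => LinearMap.pi fun j =>
    if h : (j : ℕ) < n - 1 then leval (a ⟨j, h⟩) else lcoeff F d
  have hL : ∀ d f (j : Fin n), L d f j =
      if h : (j : ℕ) < n - 1 then f.eval (a ⟨j, h⟩) else f.coeff d := by
    intro d f j
    simp only [L, LinearMap.pi_apply]
    split_ifs <;> simp [leval_apply]
  refine finrank_schurMul_span_le (k := k) (L (k - 1)) (L (2 * k - 2)) (fun f g hf hg => ?_)
    fun x hx => ?_
  · ext j
    rw [Pi.mul_apply, hL, hL, hL]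
    split_ifs
    · rw [eval_mul]
    · rw [coeff_mul_two_mul_sub_two hk hf hg]
  · have hle : RSextCode k n a ≤ (degreeLT F k).map (L (k - 1)) := by
      refine Submodule.span_le.2 ?_
      rintro _ ⟨f, hf, rfl⟩
      exact ⟨f, mem_degreeLT.2 hf, funext fun j => hL _ _ j⟩
    obtain ⟨f, hf, rfl⟩ := hle hx
    exact ⟨f, mem_degreeLT.1 hf, rfl⟩

/-- The dimension of the Schur square does not increase when passing to an equivalent code. -/
theorem finrank_schurMul_le_of_codeEquiv {F : Type*} [Field F] {n : ℕ}
    {C D : Submodule F (Fin n → F)} (h : codeEquiv C D) :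
    Module.finrank F (schurMul C C) ≤ Module.finrank F (schurMul D D) := by
  obtain ⟨π, v, -, hCD⟩ := h
  let L : (Fin n → F) →ₗ[F] (Fin n → F) :=
    LinearMap.pi fun i => (v i ^ 2) • LinearMap.proj (π i)
  have hle : schurMul C C ≤ (schurMul D D).map L := by
    refine Submodule.span_le.2 ?_
    rintro _ ⟨c, hc, d, hd, rfl⟩
    rw [← SetLike.mem_coe, hCD] at hc hd
    obtain ⟨x, hx, rfl⟩ := hc
    obtain ⟨y, hy, rfl⟩ := hd
    refine ⟨x * y, Submodule.subset_span ⟨x, hx, y, hy, rfl⟩, ?_⟩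
    ext i
    simp only [L, LinearMap.pi_apply, LinearMap.smul_apply, LinearMap.proj_apply, Pi.mul_apply,
      smul_eq_mul]
    ring
  exact (Submodule.finrank_mono hle).trans (Submodule.finrank_map_le L _)

/-- Exponents which, modulo `3`, are `0` except for a single `1` and for a `2` in each of the last
two positions. -/
def nodeExp (n w : ℕ) (j : Fin n) : ℕ :=
  if (j : ℕ) = n - 1 then 2 + 3 * w
  else if (j : ℕ) = n - 2 then 2
  else if (j : ℕ) = n - 3 then 1
  else 3 * j

theorem nodeExp_lt {n r w : ℕ} (hr : n ≤ r + 3) (hwr : w < r) (j : Fin n) :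
    nodeExp n w j < 3 * r := by
  have := j.2
  unfold nodeExp
  split_ifs <;> omega

theorem nodeExp_injective {n w : ℕ} (hw : 1 ≤ w) : Function.Injective (nodeExp n w) := by
  intro i j h
  have := i.2
  have := j.2
  unfold nodeExp at h
  ext
  split_ifs at h <;> omega

/-- A sum of exponents avoiding the last two positions is `0` or `1` modulo `3`. -/
theorem sum_nodeExp_mod_three {n w : ℕ} {Z : Finset (Fin n)}
    (hZ : ∀ j ∈ Z, (j : ℕ) ≠ n - 1 ∧ (j : ℕ) ≠ n - 2) : (∑ j ∈ Z, nodeExp n w j) % 3 ≤ 1 := by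
  have hmod : ∀ j ∈ Z, nodeExp n w j % 3 = if (j : ℕ) = n - 3 then 1 else 0 := by
    intro j hj
    have := hZ j hj
    unfold nodeExp
    split_ifs <;> omega
  rw [sum_nat_mod, sum_congr rfl hmod, ← card_filter]
  refine (Nat.mod_le _ _).trans (card_le_one.2 fun i hi j hj => ?_)
  rw [mem_filter] at hi hj
  exact Fin.ext (hi.2.trans hj.2.symm)

/-- An element of order `3r` yields `n ≤ r + 3` nodes suitable for a twisted code. -/
theorem exists_twisted_nodes {F : Type*} [Field F] {n r : ℕ} {g : F} (hg : orderOf g = 3 * r)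
    (hr3 : 3 ≤ r) (hn : 3 ≤ n) (hr : n ≤ r + 3) :
    ∃ (a : Fin n → F) (T : Finset (Fin n)), Function.Injective a ∧ (∀ j, a j ≠ 0) ∧ T.card = 2 ∧
      (∀ Z : Finset (Fin n), Disjoint Z T → ∀ t ∈ T, ∏ j ∈ Z, a j ≠ a t) ∧
      ∏ j ∈ Tᶜ, a j ≠ ∏ j ∈ T, a j := by
  have hg0 : g ≠ 0 := by
    rintro rfl
    rw [orderOf_zero] at hg
    omega
  have hpow : ∀ {s t : ℕ}, g ^ s = g ^ t → s ≡ t [MOD 3 * r] := by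
    intro s t h
    have hu : orderOf (Units.mk0 g hg0) = 3 * r := by rw [← orderOf_units, Units.val_mk0, hg]
    rw [← hu, ← pow_eq_pow_iff_modEq]
    ext
    simpa using h
  let u : Fin n := ⟨n - 2, by omega⟩
  let v : Fin n := ⟨n - 1, by omega⟩
  have huv : u ≠ v := by
    simp only [u, v, ne_eq, Fin.mk.injEq]
    omega
  have hlast : ∀ w, nodeExp n w u = 2 ∧ nodeExp n w v = 2 + 3 * w := by
    intro w
    simp only [nodeExp, u, v]
    split_ifs <;> omega
  have hoff : ∀ j : Fin n, j ∉ ({u, v} : Finset (Fin n)) → (j : ℕ) ≠ n - 1 ∧ (j : ℕ) ≠ n - 2 := by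
    intro j hj
    simp only [mem_insert, mem_singleton, not_or, Fin.ext_iff, u, v] at hj
    exact ⟨hj.2, hj.1⟩
  obtain ⟨w, hw1, hw2, hw⟩ : ∃ w, 1 ≤ w ∧ w ≤ 2 ∧
      ∏ j ∈ ({u, v}ᶜ : Finset (Fin n)), g ^ nodeExp n w j ≠ g ^ 2 * g ^ (2 + 3 * w) := by
    by_contra! hcon
    have h1 := hcon 1 le_rfl one_le_two
    have h2 := hcon 2 one_le_two le_rfl
    have hcongr : ∏ j ∈ ({u, v}ᶜ : Finset (Fin n)), g ^ nodeExp n 1 j =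
        ∏ j ∈ ({u, v}ᶜ : Finset (Fin n)), g ^ nodeExp n 2 j := by
      refine prod_congr rfl fun j hj => ?_
      rw [nodeExp, nodeExp, if_neg (hoff j (mem_compl.1 hj)).1,
        if_neg (hoff j (mem_compl.1 hj)).1]
    rw [hcongr, h2, ← pow_add, ← pow_add] at h1
    have := (Nat.modEq_iff_dvd' (by norm_num)).1 (hpow h1).symm
    have := Nat.le_of_dvd (by norm_num) this
    omega
  refine ⟨fun j => g ^ nodeExp n w j, {u, v}, ?_, fun j => pow_ne_zero _ hg0, card_pair huv,
    ?_, ?_⟩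
  · intro i j h
    exact nodeExp_injective hw1 (Nat.ModEq.eq_of_lt_of_lt (hpow h)
      (nodeExp_lt hr (by omega) i) (nodeExp_lt hr (by omega) j))
  · intro Z hZ t ht h
    have h' : g ^ ∑ j ∈ Z, nodeExp n w j = g ^ nodeExp n w t := by
      rwa [← prod_pow_eq_pow_sum]
    have hmod : (∑ j ∈ Z, nodeExp n w j) % 3 = nodeExp n w t % 3 := (hpow h').of_mul_right r
    have hle := sum_nodeExp_mod_three (w := w) fun j hj => hoff j (disjoint_left.1 hZ hj)
    rw [mem_insert, mem_singleton] at ht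
    rcases ht with rfl | rfl
    · rw [(hlast w).1] at hmod
      omega
    · rw [(hlast w).2] at hmod
      omega
  · rw [prod_pair huv, (hlast w).1, (hlast w).2]
    exact hw

/-- For `q = 2^{2m}` (`m ≥ 1`) and integers `n, k` with `3 ≤ k`,
`2k ≤ n`, `3n ≤ q + 8`, there is a linear code `C ⊆ F_q^n` of dimension `k` with
minimum Hamming distance `n - k + 1` (an MDS code) whose Schur square has dimension
exactly `2k`; in particular `C` is not equivalent to any `k`-dimensional
Reed–Solomon or extended Reed–Solomon code over `F_q`. -/
theorem exists_MDS_nonRS_even {F : Type*} [Field F] [Fintype F] [DecidableEq F]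
    (q n k m : ℕ) (hm : 1 ≤ m) (hq : q = 2 ^ (2 * m))
    (hcard : Fintype.card F = q)
    (hk3 : 3 ≤ k) (hkn : 2 * k ≤ n) (hnq : 3 * n ≤ q + 8) :
    ∃ C : Submodule F (Fin n → F),
      Module.finrank F C = k ∧
      minDist C = n - k + 1 ∧
      Module.finrank F (schurMul C C) = 2 * k ∧
      (∀ a' : Fin n → F, Function.Injective a' → ¬ codeEquiv C (RSCode k n a')) ∧
      (∀ a' : Fin (n - 1) → F, Function.Injective a' →
        ¬ codeEquiv C (RSextCode k n a')) := by
  have hchar : CharP F 2 := charP_of_card_eq_prime_pow (hcard.trans hq)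
  obtain ⟨r, hr⟩ : 3 ∣ q - 1 := by
    rw [hq, pow_mul]
    simpa using Nat.sub_dvd_pow_sub_pow 4 1 m
  obtain ⟨g, hg⟩ := IsCyclic.exists_generator (α := Fˣ)
  have hord : orderOf (g : F) = 3 * r := by
    rw [orderOf_units, orderOf_eq_card_of_forall_mem_zpowers hg, Nat.card_units,
      Nat.card_eq_fintype_card, hcard, hr]
  obtain ⟨a, T, ha, ha0, hT, hprod, hsq⟩ :=
    exists_twisted_nodes (n := n) hord (by omega) (by omega) (by omega)
  have hMDS : ∀ f : Polynomial F, f.degree < k → ∀ Z : Finset (Fin n), Z.card = k →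
      (∀ j ∈ Z, twistedEval k a T f j = 0) → f = 0 := by
    intro f hf Z hZ
    refine eq_zero_of_twistedEval_eq_zero (by omega) ha ha0 hT (fun Y hY _ t ht => ?_) hf hZ
    simp only [CharTwo.neg_eq]
    rw [← CharTwo.sub_eq_add]
    exact sub_ne_zero.2 (hprod Y hY t ht)
  have hschur := finrank_schurMul_twistedCode hk3 hkn ha ha0 hT hsq
  refine ⟨twistedCode k a T, finrank_twistedCode (by omega) hMDS,
    minDist_twistedCode (by omega) (by omega) hT hMDS, hschur, fun a' _ h => ?_, fun a' _ h => ?_⟩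
  · have := finrank_schurMul_le_of_codeEquiv h
    have := finrank_schurMul_RSCode_le (k := k) a'
    omega
  · have := finrank_schurMul_le_of_codeEquiv h
    have := finrank_schurMul_RSextCode_le (k := k) (by omega) a'
    omega
end
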